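/- arXiv:1101.0178 — 4 statements merged into one kernel-verified Lean document; each statement's English description precedes it below -/
import Mathlib

section
/- Let R be a commutative ring, L a Lie algebra over R, x ∈ L, and let d and e be derivations of L (R-linear maps with f([a,b]) = [f(a),b] + [a,f(b)]). For a derivation f, write ρₓ(f) for the linear endomorphism ad(x) ∘ ad(f(x)) ∘ ad(x) of L. Then, as linear endomorphisms of L: ρₓ(d)∘e − e∘ρₓ(d) + d∘ρₓ(e) − ρₓ(e)∘d = ad(x) ∘ ad(d(e(x)) − e(d(x))) ∘ ad(x) + ad([[d(x), e(x)], x]). -/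
theorem rho_derivation_identity (R : Type*) [CommRing R]
    (L : Type*) [LieRing L] [LieAlgebra R L]
    (x : L) (d e : L →ₗ[R] L)
    (hd : ∀ a b : L, d ⁅a, b⁆ = ⁅d a, b⁆ + ⁅a, d b⁆)
    (he : ∀ a b : L, e ⁅a, b⁆ = ⁅e a, b⁆ + ⁅a, e b⁆)
    (ρ : (L →ₗ[R] L) → (L →ₗ[R] L))
    (hρ : ∀ f : L →ₗ[R] L,
      ρ f = LieAlgebra.ad R L x ∘ₗ LieAlgebra.ad R L (f x) ∘ₗ LieAlgebra.ad R L x) :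
    ρ d ∘ₗ e - e ∘ₗ ρ d + d ∘ₗ ρ e - ρ e ∘ₗ d =
      LieAlgebra.ad R L x ∘ₗ LieAlgebra.ad R L (d (e x) - e (d x)) ∘ₗ LieAlgebra.ad R L x
        + LieAlgebra.ad R L ⁅⁅d x, e x⁆, x⁆ := by
  ext z
  simp only [hρ, LinearMap.add_apply, LinearMap.sub_apply, LinearMap.comp_apply,
    LieAlgebra.ad_apply, hd, he, lie_add, sub_lie, lie_sub, lie_lie]
  abel
end

section
/- Let k be a field of characteristic 2, q = 2^{2m+1} for some m ≥ 0, V a k-vector space, B an alternating bilinear form on V, and φ : V → V a map satisfying B(φ(x), φ(y)) = B(x,y)^q for all x, y ∈ V. If α ∈ V satisfies φ⁵(α) = α, then B(α, φ²(α))^{q³+1} = B(α, φ³(α))^{q²+1}. -/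
/-- A map scaling a bilinear form by the `q`-power map has iterates scaling it by `q ^ n`. -/
theorem LinearMap.BilinForm.apply_iterate_iterate {k V : Type*} [CommRing k] [AddCommGroup V]
    [Module k V] (B : LinearMap.BilinForm k V) {q : ℕ} {φ : V → V}
    (hφ : ∀ x y : V, B (φ x) (φ y) = (B x y) ^ q) (n : ℕ) (x y : V) :
    B (φ^[n] x) (φ^[n] y) = (B x y) ^ q ^ n := by
  induction n with
  | zero => simp
  | succ n ih => rw [Function.iterate_succ_apply', Function.iterate_succ_apply', hφ, ih,
      ← pow_mul, pow_succ]

/-- In characteristic two an alternating form is symmetric. -/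
theorem LinearMap.BilinForm.IsAlt.apply_comm_of_charTwo {k V : Type*} [CommRing k] [CharP k 2]
    [AddCommGroup V] [Module k V] {B : LinearMap.BilinForm k V} (hB : B.IsAlt) (x y : V) :
    B x y = B y x := by
  rw [← hB.neg_eq y x, CharTwo.neg_eq]

theorem suzuki_q5_point_identity (k : Type*) [Field k] [CharP k 2] (m : ℕ)
    (q : ℕ) (hq : q = 2 ^ (2 * m + 1))
    (V : Type*) [AddCommGroup V] [Module k V]
    (B : LinearMap.BilinForm k V) (hB : B.IsAlt)
    (φ : V → V) (hφ : ∀ x y : V, B (φ x) (φ y) = (B x y) ^ q)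
    (α : V) (hα : φ^[5] α = α) :
    (B α (φ^[2] α)) ^ (q ^ 3 + 1) = (B α (φ^[3] α)) ^ (q ^ 2 + 1) := by
  have h₃ : B α (φ^[2] α) ^ q ^ 3 = B α (φ^[3] α) := by
    rw [← B.apply_iterate_iterate hφ, ← Function.iterate_add_apply, hα,
      hB.apply_comm_of_charTwo]
  have h₂ : B α (φ^[3] α) ^ q ^ 2 = B α (φ^[2] α) := by
    rw [← B.apply_iterate_iterate hφ, ← Function.iterate_add_apply, hα,
      hB.apply_comm_of_charTwo]
  rw [pow_succ _ (q ^ 3), pow_succ _ (q ^ 2), h₃, h₂, mul_comm]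
end

section
/- Let p be a prime, m ≥ 1, q₀ = p^m, and let k be a field of characteristic p. If ω : Fin 3 → k satisfies ωᵢ^{q₀⁸} = ωᵢ for each i, then (Σᵢ ωᵢ^{q₀⁵+1})^{q₀³+1} = (Σᵢ ωᵢ^{q₀³+1})^{q₀⁵+1}. -/
/-- If every `ω i` is fixed by the `q ^ (a + b)`-power map, where `q` is a power of the
characteristic, then raising to the power `q ^ b` exchanges the exponents `q ^ a + 1` and
`q ^ b + 1` in the diagonal sums. -/
theorem sum_pow_add_one_pow_of_frobenius_fixed {R ι : Type*} [CommSemiring R] (p : ℕ)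
    [ExpChar R p] (s : Finset ι) (m a b : ℕ) (ω : ι → R)
    (hω : ∀ i ∈ s, ω i ^ (p ^ m) ^ (a + b) = ω i) :
    (∑ i ∈ s, ω i ^ ((p ^ m) ^ a + 1)) ^ (p ^ m) ^ b = ∑ i ∈ s, ω i ^ ((p ^ m) ^ b + 1) := by
  rw [← pow_mul p m b, sum_pow_char_pow, pow_mul p m b]
  refine Finset.sum_congr rfl fun i hi => ?_
  rw [← pow_mul, add_mul, ← pow_add, one_mul, pow_add, hω i hi, pow_succ']

theorem fermat_q4_point_identity (p : ℕ) (hp : p.Prime) (m : ℕ) (hm : 1 ≤ m)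
    (q₀ : ℕ) (hq₀ : q₀ = p ^ m)
    (k : Type*) [Field k] [CharP k p]
    (ω : Fin 3 → k) (hω : ∀ i, ω i ^ q₀ ^ 8 = ω i) :
    (∑ i, ω i ^ (q₀ ^ 5 + 1)) ^ (q₀ ^ 3 + 1) = (∑ i, ω i ^ (q₀ ^ 3 + 1)) ^ (q₀ ^ 5 + 1) := by
  subst hq₀
  have : ExpChar k p := .prime hp
  rw [pow_succ, pow_succ _ ((p ^ m) ^ 5),
    sum_pow_add_one_pow_of_frobenius_fixed p _ m 5 3 ω fun i _ => hω i,
    sum_pow_add_one_pow_of_frobenius_fixed p _ m 3 5 ω fun i _ => hω i, mul_comm]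
end

section
/- Let k be a field of characteristic 2 and q = 2^{2m+1} for some m ≥ 0. Let M be a module over the power series ring k[[t]], let B : M × M → k[[t]] be a k[[t]]-bilinear alternating form, and let φ : M → M be an additive map satisfying φ(f·x) = f^q·φ(x) for all f ∈ k[[t]], x ∈ M, and B(φ(x), φ(y)) = B(x,y)^q for all x, y ∈ M. Suppose β ∈ M satisfies φ(β) = β, and α ∈ M satisfies α − β ∈ t·M. Then B(α, φ³(α))^{q+1} + B(α, φ⁴(α)) · B(α, φ²(α))^q lies in the ideal (t^{q³}) of k[[t]]. -/
/-- If `φ` is additive and scales scalars by `f ↦ f ^ q`, then iterating it moves a point congruent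
to a fixed point `β` modulo `r` to one congruent to `β` modulo `r ^ q ^ n`. -/
theorem iterate_add_smul_eq_add_pow_smul {R M : Type*} [CommRing R] [AddCommGroup M] [Module R M]
    {q : ℕ} {φ : M → M} (hadd : ∀ x y : M, φ (x + y) = φ x + φ y)
    (hsmul : ∀ (f : R) (x : M), φ (f • x) = f ^ q • φ x)
    {β : M} (hβ : φ β = β) {r : R} {γ : M} (n : ℕ) :
    φ^[n] (β + r • γ) = β + r ^ q ^ n • φ^[n] γ := by
  induction n with
  | zero => simp
  | succ n ih =>
    rw [Function.iterate_succ_apply', ih, hadd, hβ, hsmul, ← pow_mul, ← pow_succ,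
      Function.iterate_succ_apply']

theorem suzuki_Fq_point_local_vanishing (k : Type*) [Field k] [CharP k 2] (m : ℕ)
    (q : ℕ) (hq : q = 2 ^ (2 * m + 1))
    (M : Type*) [AddCommGroup M] [Module (PowerSeries k) M]
    (B : M →ₗ[PowerSeries k] M →ₗ[PowerSeries k] PowerSeries k)
    (hBalt : ∀ x : M, B x x = 0)
    (φ : M → M) (hadd : ∀ x y : M, φ (x + y) = φ x + φ y)
    (hsmul : ∀ (f : PowerSeries k) (x : M), φ (f • x) = f ^ q • φ x)
    (hφ : ∀ x y : M, B (φ x) (φ y) = (B x y) ^ q)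
    (β : M) (hβ : φ β = β)
    (α : M) (hα : ∃ γ : M, α - β = (PowerSeries.X : PowerSeries k) • γ) :
    B α (φ^[3] α) ^ (q + 1) + B α (φ^[4] α) * B α (φ^[2] α) ^ q ∈
      Ideal.span {(PowerSeries.X : PowerSeries k) ^ (q ^ 3)} := by
  obtain ⟨γ, hγ⟩ := hα
  have hαβ : α = β + (PowerSeries.X : PowerSeries k) • γ := by rw [← hγ]; abel
  have hiter (n : ℕ) :
      φ^[n] α = β + (PowerSeries.X : PowerSeries k) ^ q ^ n • φ^[n] γ := by
    rw [hαβ, iterate_add_smul_eq_add_pow_smul hadd hsmul hβ]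
  have hq0 : 0 < q := by rw [hq]; positivity
  have h₄ : (PowerSeries.X : PowerSeries k) ^ q ^ 4 =
      PowerSeries.X ^ q ^ 3 * PowerSeries.X ^ (q ^ 4 - q ^ 3) := by
    rw [← pow_add, Nat.add_sub_cancel' (Nat.pow_le_pow_right hq0 (by norm_num))]
  have h₁₄ : B α (φ^[3] α) ^ q = B (φ α) (φ^[4] α) := by
    rw [← hφ, Function.iterate_succ_apply' φ 3]
  have h₁₃ : B α (φ^[2] α) ^ q = B (φ α) (φ^[3] α) := by
    rw [← hφ, Function.iterate_succ_apply' φ 2]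
  have h2 : (2 : PowerSeries k) = 0 := by
    rw [← map_ofNat (PowerSeries.C (R := k)) 2, CharTwo.two_eq_zero, map_zero]
  rw [pow_succ _ q, h₁₄, h₁₃, hiter 3, hiter 4, h₄, Ideal.mem_span_singleton]
  simp only [map_add, map_smul, smul_eq_mul]
  generalize (PowerSeries.X : PowerSeries k) ^ q ^ 3 = u
  generalize (PowerSeries.X : PowerSeries k) ^ (q ^ 4 - q ^ 3) = v
  generalize B α β = a, B (φ α) β = b, B α (φ^[3] γ) = c, B (φ α) (φ^[3] γ) = d,
    B α (φ^[4] γ) = e, B (φ α) (φ^[4] γ) = f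
  refine ⟨b * c + v * f * a + u * v * f * c + a * d + v * e * b + u * v * e * d, ?_⟩
  linear_combination a * b * h2
end
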